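/- Suppose α ≥ 1 and n ≥ 2. Then the mean of W_α under Jack_α measure is zero: Σ_{λ partition of n} π_α(λ)·W_α(λ) = 0. -/

import Mathlib

open Finset

namespace JackTest

def colLen {n : ℕ} (lam : n.Partition) (j : ℕ) : ℕ :=
  (lam.parts.filter (fun p => j < p)).card

def rowLen {n : ℕ} (lam : n.Partition) (i : ℕ) : ℕ :=
  ((Finset.range n).filter (fun j => i < colLen lam j)).card

def cells {n : ℕ} (lam : n.Partition) : Finset (ℕ × ℕ) :=
  (Finset.range n ×ˢ Finset.range n).filter (fun s => s.2 < rowLen lam s.1)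

def arm {n : ℕ} (lam : n.Partition) (s : ℕ × ℕ) : ℕ := rowLen lam s.1 - (s.2 + 1)

def leg {n : ℕ} (lam : n.Partition) (s : ℕ × ℕ) : ℕ := colLen lam s.2 - (s.1 + 1)

noncomputable def cLow (α : ℝ) {n : ℕ} (lam : n.Partition) : ℝ :=
  ∏ s ∈ cells lam, (α * arm lam s + leg lam s + 1)

noncomputable def cUp (α : ℝ) {n : ℕ} (lam : n.Partition) : ℝ :=
  ∏ s ∈ cells lam, (α * arm lam s + leg lam s + α)

noncomputable def jackP (α : ℝ) {n : ℕ} (lam : n.Partition) : ℝ :=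
  α ^ n * (n.factorial) / (cLow α lam * cUp α lam)

def nStat {n : ℕ} (lam : n.Partition) : ℕ := ∑ i ∈ Finset.range n, i * rowLen lam i

def nStatConj {n : ℕ} (lam : n.Partition) : ℕ := ∑ j ∈ Finset.range n, j * colLen lam j

noncomputable def W (α : ℝ) {n : ℕ} (lam : n.Partition) : ℝ :=
  (α * nStatConj lam - nStat lam) / Real.sqrt (α * n.choose 2)

noncomputable def Phi (x : ℝ) : ℝ :=
  (Real.sqrt (2 * Real.pi))⁻¹ * ∫ t in Set.Iic x, Real.exp (-t ^ 2 / 2)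

/-- The residue of `∏ i ∈ s, (1 + c / (u - x i))` at `u = x r`, divided by `c`. -/
noncomputable def residue {ι : Type*} [DecidableEq ι] (c : ℝ) (x : ι → ℝ) (s : Finset ι) (r : ι) :
    ℝ :=
  ∏ i ∈ s.erase r, (1 + c / (x r - x i))

section Residue

variable {ι : Type*} [DecidableEq ι] (c : ℝ) (x : ι → ℝ)

lemma residue_insert_of_mem {s : Finset ι} {a r : ι} (ha : a ∉ s) (hr : r ∈ s) :
    residue c x (insert a s) r = residue c x s r * (1 + c / (x r - x a)) := by
  have hne : a ≠ r := fun h => ha (h ▸ hr)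
  rw [residue, erase_insert_of_ne hne, prod_insert (fun h => ha (mem_of_mem_erase h)), mul_comm]
  rfl

lemma residue_insert_self {s : Finset ι} {a : ι} (ha : a ∉ s) :
    residue c x (insert a s) a = ∏ i ∈ s, (1 + c / (x a - x i)) := by
  rw [residue, erase_insert ha]

lemma prod_one_add_div {s : Finset ι} (hx : Set.InjOn x s) (u : ℝ) (hu : ∀ i ∈ s, u ≠ x i) :
    ∏ i ∈ s, (1 + c / (u - x i)) = 1 + c * ∑ r ∈ s, residue c x s r / (u - x r) := by
  induction s using Finset.induction_on generalizing u with
  | empty => simp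
  | insert a s ha ih =>
    have hxs : Set.InjOn x s := hx.mono (by simp)
    have hax : ∀ i ∈ s, x a ≠ x i := fun i hi h =>
      ha (hx (by simp) (by simp [hi]) h ▸ hi)
    have hua : u - x a ≠ 0 := sub_ne_zero.2 (hu a (by simp))
    have hus : ∀ i ∈ s, u ≠ x i := fun i hi => hu i (by simp [hi])
    rw [prod_insert ha, sum_insert ha, residue_insert_self c x ha, ih hxs u hus, ih hxs _ hax]
    have key : ∑ r ∈ s, residue c x (insert a s) r / (u - x r) =
        ∑ r ∈ s, residue c x s r / (u - x r) + c / (u - x a) *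
          (∑ r ∈ s, residue c x s r / (u - x r) - ∑ r ∈ s, residue c x s r / (x a - x r)) := by
      rw [← sum_sub_distrib, mul_sum, ← sum_add_distrib]
      refine sum_congr rfl fun r hr => ?_
      rw [residue_insert_of_mem c x ha hr]
      have h1 : u - x r ≠ 0 := sub_ne_zero.2 (hus r hr)
      have h2 : x a - x r ≠ 0 := sub_ne_zero.2 (hax r hr)
      have h3 : x r - x a ≠ 0 := sub_ne_zero.2 (hax r hr).symm
      field_simp
      ring
    rw [key]
    field_simp
    ring

lemma sum_residue {s : Finset ι} (hx : Set.InjOn x s) :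
    ∑ r ∈ s, residue c x s r = #s := by
  induction s using Finset.induction_on with
  | empty => simp
  | insert a s ha ih =>
    have hxs : Set.InjOn x s := hx.mono (by simp)
    have hax : ∀ i ∈ s, x a ≠ x i := fun i hi h =>
      ha (hx (by simp) (by simp [hi]) h ▸ hi)
    rw [sum_insert ha, residue_insert_self c x ha, prod_one_add_div c x hxs _ hax,
      card_insert_of_notMem ha, Nat.cast_succ, ← ih hxs, mul_sum, add_assoc, ← sum_add_distrib,
      add_comm]
    congr 1
    refine sum_congr rfl fun r hr => ?_
    rw [residue_insert_of_mem c x ha hr]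
    have h2 : x a - x r ≠ 0 := sub_ne_zero.2 (hax r hr)
    have h3 : x r - x a ≠ 0 := sub_ne_zero.2 (hax r hr).symm
    field_simp
    ring

lemma sum_mul_residue {s : Finset ι} (hx : Set.InjOn x s) :
    ∑ r ∈ s, x r * residue c x s r = ∑ r ∈ s, x r + c * (#s * (#s - 1) / 2) := by
  induction s using Finset.induction_on with
  | empty => simp
  | insert a s ha ih =>
    have hxs : Set.InjOn x s := hx.mono (by simp)
    have hax : ∀ i ∈ s, x a ≠ x i := fun i hi h =>
      ha (hx (by simp) (by simp [hi]) h ▸ hi)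
    have key : ∑ r ∈ s, x r * residue c x (insert a s) r = ∑ r ∈ s, x r * residue c x s r
        + c * ∑ r ∈ s, residue c x s r - x a * c * ∑ r ∈ s, residue c x s r / (x a - x r) := by
      rw [mul_sum, mul_sum, ← sum_add_distrib, ← sum_sub_distrib]
      refine sum_congr rfl fun r hr => ?_
      rw [residue_insert_of_mem c x ha hr]
      have h2 : x a - x r ≠ 0 := sub_ne_zero.2 (hax r hr)
      have h3 : x r - x a ≠ 0 := sub_ne_zero.2 (hax r hr).symm
      field_simp
      ring
    rw [sum_insert ha, residue_insert_self c x ha, prod_one_add_div c x hxs _ hax,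
      card_insert_of_notMem ha, key, sum_residue c x hxs, ih hxs, sum_insert ha, Nat.cast_succ]
    ring

end Residue

/-- The anisotropic content `α * f i - i` of the first box to the right of row `i`. -/
noncomputable def rowContent (α : ℝ) (f : ℕ → ℕ) (i : ℕ) : ℝ := α * f i - i

/-- The sum of the anisotropic contents of the boxes of a diagram with row lengths `f`. -/
noncomputable def contentSum (α : ℝ) (M : ℕ) (f : ℕ → ℕ) : ℝ :=
  ∑ i ∈ range M, (α * (f i * (f i - 1) / 2) - i * f i)

/-- The product of the two deformed hook lengths of a box with arm `a` and leg `d`. -/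
noncomputable def hook (α a d : ℝ) : ℝ := (α * a + d + 1) * (α * a + d + α)

/-- The product of `hook α t d` over the arms `t < k`. -/
noncomputable def hookProd (α d : ℝ) (k : ℕ) : ℝ := ∏ t ∈ range k, hook α t d

/-- The product of all deformed hook lengths as a product over pairs of rows. -/
noncomputable def rowHookProd (α : ℝ) (M : ℕ) (f : ℕ → ℕ) : ℝ :=
  (∏ i ∈ range M, hookProd α (M - i - 1) (f i)) *
    ∏ i ∈ range M, ∏ k ∈ range M,
      if i < k then hookProd α (k - i - 1) (f i - f k) / hookProd α (k - i) (f i - f k) else 1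

/-- Kerov's transition probability for adding a box to row `r`. -/
noncomputable def upWeight (α : ℝ) (M : ℕ) (f : ℕ → ℕ) (r : ℕ) : ℝ :=
  residue 1 (rowContent α f) (range M) r / (rowContent α f r + M)

/-- The probability of removing a box from row `r`, scaled by `α` times the number of boxes. -/
noncomputable def downWeight (α : ℝ) (M : ℕ) (f : ℕ → ℕ) (r : ℕ) : ℝ :=
  residue (-1) (rowContent α f) (range M) r * (rowContent α f r - 1 + M)

/-- Sequences of row lengths of diagrams with `m` boxes and at most `M` rows. -/
noncomputable def diagrams (M m : ℕ) : Finset (ℕ → ℕ) := by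
  classical exact (piAntidiag (range M) m).filter Antitone

lemma mem_diagrams {M m : ℕ} {f : ℕ → ℕ} :
    f ∈ diagrams M m ↔ Antitone f ∧ ∑ i ∈ range M, f i = m ∧ ∀ i, f i ≠ 0 → i < M := by
  simp [diagrams, mem_piAntidiag, and_comm]

section Growth

variable {α : ℝ} {M m : ℕ} {f : ℕ → ℕ}

lemma rowContent_add_one_le (hα : 0 < α) (hf : Antitone f) {i j : ℕ} (hij : i < j) :
    rowContent α f j + 1 ≤ rowContent α f i := by
  have h1 : (f j : ℝ) ≤ f i := by exact_mod_cast hf hij.le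
  have h2 : (i : ℝ) + 1 ≤ j := by exact_mod_cast hij
  unfold rowContent
  nlinarith

lemma rowContent_injective (hα : 0 < α) (hf : Antitone f) : (rowContent α f).Injective := by
  have : StrictAnti (rowContent α f) := fun i j hij => by
    linarith [rowContent_add_one_le hα hf hij]
  exact this.injective

lemma rowContent_add_pos (hα : 0 < α) {r : ℕ} (hr : r < M) : 0 < rowContent α f r + M := by
  have h2 : (r : ℝ) < M := by exact_mod_cast hr
  have : 0 ≤ α * f r := by positivity
  unfold rowContent
  linarith

lemma sum_downWeight (hα : 0 < α) (hf : f ∈ diagrams M m) :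
    ∑ r ∈ range M, downWeight α M f r = α * m := by
  obtain ⟨hf, hm, -⟩ := mem_diagrams.1 hf
  have hinj : Set.InjOn (rowContent α f) (range M) := (rowContent_injective hα hf).injOn
  have h1 := sum_residue (-1) _ hinj
  have h2 := sum_mul_residue (-1) _ hinj
  have h3 : ∑ r ∈ range M, rowContent α f r = α * m - M * (M - 1) / 2 := by
    have h4 : ∀ K : ℕ, ∑ i ∈ range K, (i : ℝ) = K * (K - 1) / 2 := fun K => by
      induction K with
      | zero => simp
      | succ K ih => rw [sum_range_succ, ih]; push_cast; ring
    simp only [rowContent, sum_sub_distrib, ← mul_sum, h4]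
    rw [← hm]; push_cast; ring
  rw [card_range] at h1 h2
  calc ∑ r ∈ range M, downWeight α M f r
      = ∑ r ∈ range M, rowContent α f r * residue (-1) (rowContent α f) (range M) r
        + (M - 1) * ∑ r ∈ range M, residue (-1) (rowContent α f) (range M) r := by
        rw [mul_sum, ← sum_add_distrib]
        exact sum_congr rfl fun r _ => by unfold downWeight; ring
    _ = α * m := by rw [h1, h2, h3]; ring

lemma last_row_eq_zero (hmM : m < M) (hf : f ∈ diagrams M m) : f (M - 1) = 0 := by
  obtain ⟨hf, hm, -⟩ := mem_diagrams.1 hf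
  by_contra h
  have : ∑ i ∈ range M, 1 ≤ ∑ i ∈ range M, f i := sum_le_sum fun i hi => by
    have := hf (show i ≤ M - 1 by have := mem_range.1 hi; omega)
    omega
  simp at this
  omega

lemma sum_upWeight (hα : 0 < α) (hmM : m < M) (hf : f ∈ diagrams M m) :
    ∑ r ∈ range M, upWeight α M f r = 1 := by
  have h0 := last_row_eq_zero hmM hf
  obtain ⟨hf, hm, -⟩ := mem_diagrams.1 hf
  have hinj : Set.InjOn (rowContent α f) (range M) := (rowContent_injective hα hf).injOn
  have h := prod_one_add_div 1 _ hinj (-M : ℝ) fun i hi => by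
    have := rowContent_add_pos (f := f) hα (mem_range.1 hi)
    linarith
  rw [prod_eq_zero (i := M - 1) (by simp; omega)] at h
  · have h2 : ∑ r ∈ range M, upWeight α M f r =
        -∑ r ∈ range M, residue 1 (rowContent α f) (range M) r / (-M - rowContent α f r) := by
      rw [← sum_neg_distrib]
      refine sum_congr rfl fun r _ => ?_
      rw [upWeight, ← div_neg]
      congr 1
      ring
    linarith
  · have : ((M - 1 : ℕ) : ℝ) = M - 1 := by rw [Nat.cast_sub (by omega)]; simp
    have h1 : (-M : ℝ) - (α * (0 : ℕ) - (M - 1)) = -1 := by push_cast; ring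
    rw [rowContent, h0, this, h1]
    norm_num

lemma sum_upWeight_mul_rowContent (hα : 0 < α) (hmM : m < M) (hf : f ∈ diagrams M m) :
    ∑ r ∈ range M, upWeight α M f r * rowContent α f r = 0 := by
  have h1 := sum_upWeight hα hmM hf
  obtain ⟨hf, hm, -⟩ := mem_diagrams.1 hf
  have hinj : Set.InjOn (rowContent α f) (range M) := (rowContent_injective hα hf).injOn
  have h2 := sum_residue 1 _ hinj
  rw [card_range] at h2
  have h3 : ∑ r ∈ range M, upWeight α M f r * rowContent α f r =
      ∑ r ∈ range M, residue 1 (rowContent α f) (range M) r -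
        M * ∑ r ∈ range M, upWeight α M f r := by
    rw [mul_sum, ← sum_sub_distrib]
    refine sum_congr rfl fun r hr => ?_
    have := (rowContent_add_pos (f := f) hα (mem_range.1 hr)).ne'
    unfold upWeight
    field_simp
    ring
  rw [h3, h1, h2]; ring

lemma hook_pos (hα : 0 < α) {a d : ℝ} (ha : 0 ≤ a) (hd : 0 ≤ d) : 0 < hook α a d := by
  unfold hook; positivity

lemma hookProd_pos (hα : 0 < α) {d : ℝ} (hd : 0 ≤ d) (k : ℕ) : 0 < hookProd α d k :=
  prod_pos fun _ _ => hook_pos hα (Nat.cast_nonneg _) hd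

lemma hookProd_succ (α d : ℝ) (k : ℕ) : hookProd α d (k + 1) = hookProd α d k * hook α k d :=
  prod_range_succ _ _

lemma hookProd_div_succ (α d : ℝ) (k : ℕ) :
    hookProd α (d - 1) (k + 1) / hookProd α d (k + 1) =
      hookProd α (d - 1) k / hookProd α d k * (hook α k (d - 1) / hook α k d) := by
  rw [hookProd_succ, hookProd_succ, mul_div_mul_comm]

lemma rowHookProd_pos (hα : 0 < α) (M : ℕ) (f : ℕ → ℕ) : 0 < rowHookProd α M f := by
  refine mul_pos (prod_pos fun i hi => hookProd_pos hα ?_ _)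
    (prod_pos fun i _ => prod_pos fun k _ => ?_)
  · have : (i : ℝ) + 1 ≤ M := by exact_mod_cast mem_range.1 hi
    linarith
  · split_ifs with h
    · have : (i : ℝ) + 1 ≤ k := by exact_mod_cast h
      exact div_pos (hookProd_pos hα (by linarith) _) (hookProd_pos hα (by linarith) _)
    · exact one_pos

lemma prod_prod_pairs (s : Finset ℕ) {r : ℕ} (hr : r ∈ s) (R : ℕ → ℝ) :
    ∏ i ∈ s, ∏ k ∈ s, (if i < k then if i = r then R k else if k = r then R i else 1 else 1) =
      ∏ i ∈ s.erase r, R i := by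
  rw [← mul_prod_erase s _ hr, ← mul_prod_erase s _ hr]
  have h : ∀ i ∈ s.erase r, ∏ k ∈ s,
      (if i < k then if i = r then R k else if k = r then R i else 1 else 1) =
        if i < r then R i else 1 := fun i hi => by
    rw [prod_eq_single_of_mem r hr]
    · simp [ne_of_mem_erase hi]
    · intro k _ hk
      simp [ne_of_mem_erase hi, hk]
  rw [prod_congr rfl h]
  simp only [lt_self_iff_false, if_true, if_false, one_mul]
  rw [← prod_mul_distrib]
  refine prod_congr rfl fun i hi => ?_
  rcases lt_or_gt_of_ne (ne_of_mem_erase hi) with h | h <;> simp [h, h.not_gt]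

lemma rowHookProd_update (hα : 0 < α) (hf : Antitone f) {r : ℕ} (hr : r < M)
    (hg : Antitone (Function.update f r (f r + 1))) :
    rowHookProd α M (Function.update f r (f r + 1)) = rowHookProd α M f *
      ((rowContent α f r + M) * (rowContent α f r + M - 1 + α) *
        ∏ i ∈ (range M).erase r,
          ((rowContent α f r - rowContent α f i) * (rowContent α f r - rowContent α f i + α - 1) /
            ((rowContent α f r - rowContent α f i + 1) *
              (rowContent α f r - rowContent α f i + α)))) := by
  have hrM : r ∈ range M := mem_range.2 hr
  unfold rowHookProd
  rw [← prod_prod_pairs (range M) hrM]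
  have h1 : ∏ i ∈ range M, hookProd α (M - i - 1) (Function.update f r (f r + 1) i) =
      (∏ i ∈ range M, hookProd α (M - i - 1) (f i)) *
        ((rowContent α f r + M) * (rowContent α f r + M - 1 + α)) := by
    rw [← mul_prod_erase _ _ hrM, ← mul_prod_erase _ (fun i => hookProd α _ (f i)) hrM,
      Function.update_self, hookProd_succ]
    rw [prod_congr rfl fun i hi => by rw [Function.update_of_ne (ne_of_mem_erase hi)]]
    unfold hook rowContent
    ring
  rw [h1, mul_mul_mul_comm, ← prod_mul_distrib]
  congr 1
  refine prod_congr rfl fun i _ => ?_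
  rw [← prod_mul_distrib]
  refine prod_congr rfl fun k _ => ?_
  split_ifs with hik hi hk
  · subst hi
    have hd : (i : ℝ) + 1 ≤ k := by exact_mod_cast hik
    have hfk : f k ≤ f i := hf hik.le
    rw [Function.update_self, Function.update_of_ne hik.ne', Nat.sub_add_comm hfk,
      hookProd_div_succ]
    congr 1
    unfold hook rowContent
    rw [Nat.cast_sub hfk]
    congr 1 <;> ring
  · subst hk
    have hd : (i : ℝ) + 1 ≤ k := by exact_mod_cast hik
    have hfk : f k + 1 ≤ f i := by simpa [Function.update_of_ne hi] using hg hik.le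
    rw [Function.update_self, Function.update_of_ne hi]
    obtain ⟨a, ha⟩ := Nat.exists_eq_add_of_le hfk
    have e1 : f i - f k = a + 1 := by omega
    have e2 : f i - (f k + 1) = a := by omega
    have hp : 0 < hook α a ((k : ℝ) - i) := hook_pos hα (Nat.cast_nonneg _) (by linarith)
    have hp' : 0 < hook α a ((k : ℝ) - i - 1) := hook_pos hα (Nat.cast_nonneg _) (by linarith)
    rw [e1, e2, hookProd_div_succ, mul_assoc]
    symm
    refine mul_right_eq_self₀.2 (Or.inl ?_)
    have e3 : (rowContent α f k - rowContent α f i + 1) *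
        (rowContent α f k - rowContent α f i + α) = hook α a ((k : ℝ) - i - 1) := by
      unfold hook rowContent; rw [ha]; push_cast; ring
    have e4 : (rowContent α f k - rowContent α f i) *
        (rowContent α f k - rowContent α f i + α - 1) = hook α a ((k : ℝ) - i) := by
      unfold hook rowContent; rw [ha]; push_cast; ring
    rw [e3, e4]
    field_simp
  · rw [Function.update_of_ne hi, Function.update_of_ne hk, mul_one]
  · rw [mul_one]

lemma rowContent_update_self (α : ℝ) (f : ℕ → ℕ) (r : ℕ) :
    rowContent α (Function.update f r (f r + 1)) r = rowContent α f r + α := by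
  simp [rowContent]; ring

lemma rowContent_update_of_ne (α : ℝ) (f : ℕ → ℕ) {r i : ℕ} (h : i ≠ r) (c : ℕ) :
    rowContent α (Function.update f r c) i = rowContent α f i := by
  simp [rowContent, h]

lemma upWeight_div_rowHookProd (hα : 0 < α) (hf : Antitone f) {r : ℕ} (hr : r < M)
    (hg : Antitone (Function.update f r (f r + 1))) :
    upWeight α M f r / rowHookProd α M f =
      downWeight α M (Function.update f r (f r + 1)) r /
        rowHookProd α M (Function.update f r (f r + 1)) := by
  have hH := (rowHookProd_pos hα M f).ne'
  have hH' := (rowHookProd_pos hα M (Function.update f r (f r + 1))).ne'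
  rw [div_eq_div_iff hH hH', rowHookProd_update hα hf hr hg]
  have hX := (rowContent_add_pos (f := f) hα hr).ne'
  have key : residue 1 (rowContent α f) (range M) r * ∏ i ∈ (range M).erase r,
          ((rowContent α f r - rowContent α f i) * (rowContent α f r - rowContent α f i + α - 1) /
            ((rowContent α f r - rowContent α f i + 1) *
              (rowContent α f r - rowContent α f i + α))) =
      residue (-1) (rowContent α (Function.update f r (f r + 1))) (range M) r := by
    unfold residue
    rw [← prod_mul_distrib]
    refine prod_congr rfl fun i hi => ?_
    have hne := ne_of_mem_erase hi
    rw [rowContent_update_self, rowContent_update_of_ne _ _ hne]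
    set D := rowContent α f r - rowContent α f i with hD
    have hD' : rowContent α f r + α - rowContent α f i = D + α := by rw [hD]; ring
    rw [hD']
    have h : D ≠ 0 ∧ D + 1 ≠ 0 ∧ D + α ≠ 0 := by
      rcases lt_or_gt_of_ne hne with h | h
      · have := rowContent_add_one_le hα hg h
        rw [rowContent_update_self, rowContent_update_of_ne _ _ hne] at this
        refine ⟨ne_of_lt ?_, ne_of_lt ?_, ne_of_lt ?_⟩ <;> linarith
      · have := rowContent_add_one_le hα hf h
        refine ⟨ne_of_gt ?_, ne_of_gt ?_, ne_of_gt ?_⟩ <;> linarith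
    obtain ⟨h0, h1, h2⟩ := h
    field_simp
    ring
  unfold upWeight downWeight
  rw [← key, rowContent_update_self]
  field_simp
  ring

lemma contentSum_update (α : ℝ) (f : ℕ → ℕ) {r : ℕ} (hr : r < M) :
    contentSum α M (Function.update f r (f r + 1)) = contentSum α M f + rowContent α f r := by
  have hrM : r ∈ range M := mem_range.2 hr
  unfold contentSum
  rw [← add_sum_erase _ _ hrM,
    ← add_sum_erase _ (fun i => α * ((f i : ℝ) * (f i - 1) / 2) - i * f i) hrM,
    sum_congr rfl fun i hi => by rw [Function.update_of_ne (ne_of_mem_erase hi)],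
    Function.update_self, rowContent]
  push_cast
  ring

lemma upWeight_eq_zero (hf : Antitone f) {r : ℕ} (hr : r < M)
    (hg : ¬ Antitone (Function.update f r (f r + 1))) : upWeight α M f r = 0 := by
  have h : ∃ i, i + 1 = r ∧ f i = f r := by
    by_contra! h
    refine hg (antitone_nat_of_succ_le fun i => ?_)
    have h1 := hf (Nat.le_add_right i 1)
    rcases eq_or_ne (i + 1) r with e | e
    · have := h i e
      subst e
      simp only [Function.update_self, Function.update_of_ne (Nat.lt_succ_self i).ne]
      omega
    · rw [Function.update_of_ne e]
      rcases eq_or_ne i r with e' | e'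
      · subst e'; simp; omega
      · rwa [Function.update_of_ne e']
  obtain ⟨i, rfl, hi⟩ := h
  unfold upWeight residue
  rw [prod_eq_zero (i := i) (by simp; omega), zero_div]
  unfold rowContent
  rw [hi]
  push_cast
  rw [show α * (f (i + 1) : ℝ) - (i + 1) - (α * f (i + 1) - i) = -1 by ring]
  norm_num

lemma downWeight_eq_zero (hf : f ∈ diagrams M m) {r : ℕ} (hr : r < M)
    (h : f r ≤ f (r + 1)) : downWeight α M f r = 0 := by
  obtain ⟨hf, -, hM⟩ := mem_diagrams.1 hf
  have h : f (r + 1) = f r := le_antisymm (hf (Nat.le_add_right r 1)) h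
  unfold downWeight residue
  rcases (Nat.succ_le_of_lt hr).eq_or_lt with e | e
  · have h0 : f r = 0 := by
      by_contra h0
      have := hM (r + 1) (h ▸ h0)
      omega
    rw [← e, rowContent, h0]
    push_cast
    ring
  · rw [prod_eq_zero (i := r + 1) (by simp; omega), zero_mul]
    unfold rowContent
    rw [h]
    push_cast
    rw [show α * (f r : ℝ) - r - (α * f r - (r + 1)) = 1 by ring]
    norm_num

lemma update_mem_diagrams (hf : f ∈ diagrams M m) {r : ℕ} (hr : r < M)
    (hg : Antitone (Function.update f r (f r + 1))) :
    Function.update f r (f r + 1) ∈ diagrams M (m + 1) := by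
  obtain ⟨hf, hm, hM⟩ := mem_diagrams.1 hf
  have hrM : r ∈ range M := mem_range.2 hr
  refine mem_diagrams.2 ⟨hg, ?_, fun i hi => ?_⟩
  · rw [sum_update_of_mem hrM, sdiff_singleton_eq_erase, ← hm, ← add_sum_erase _ f hrM]
    ring
  · rcases eq_or_ne i r with rfl | e
    · exact hr
    · exact hM i (by rwa [Function.update_of_ne e] at hi)

lemma update_pred_mem_diagrams (hf : f ∈ diagrams M (m + 1)) {r : ℕ} (hr : r < M)
    (h : f (r + 1) < f r) : Function.update f r (f r - 1) ∈ diagrams M m := by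
  obtain ⟨hf, hm, hM⟩ := mem_diagrams.1 hf
  have hrM : r ∈ range M := mem_range.2 hr
  refine mem_diagrams.2 ⟨antitone_nat_of_succ_le fun i => ?_, ?_, fun i hi => ?_⟩
  · have h1 := hf (Nat.le_add_right i 1)
    rcases eq_or_ne i r with rfl | e
    · rw [Function.update_self, Function.update_of_ne (by omega : i + 1 ≠ i)]
      omega
    · rw [Function.update_of_ne e]
      refine le_trans ?_ h1
      rcases eq_or_ne (i + 1) r with rfl | e
      · simp
      · rw [Function.update_of_ne e]
  · rw [sum_update_of_mem hrM, sdiff_singleton_eq_erase]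
    rw [← add_sum_erase _ f hrM] at hm
    omega
  · rcases eq_or_ne i r with rfl | e
    · exact hr
    · exact hM i (by rwa [Function.update_of_ne e] at hi)

lemma sum_downWeight_eq_sum_upWeight (hα : 0 < α) (M m : ℕ) :
    ∑ g ∈ diagrams M (m + 1), ∑ r ∈ range M,
        downWeight α M g r / rowHookProd α M g * contentSum α M g =
      ∑ f ∈ diagrams M m, ∑ r ∈ range M,
        upWeight α M f r / rowHookProd α M f * (contentSum α M f + rowContent α f r) := by
  classical
  rw [← sum_product', ← sum_product']
  symm
  refine sum_bij_ne_zero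
    (fun p _ _ => (Function.update p.1 p.2 (p.1 p.2 + 1), p.2)) ?_ ?_ ?_ ?_
  all_goals simp only [mem_product, mem_range, Prod.forall]
  · intro f r ⟨hf, hr⟩ hne
    refine ⟨update_mem_diagrams hf hr ?_, hr⟩
    by_contra hg
    exact hne (by rw [upWeight_eq_zero (mem_diagrams.1 hf).1 hr hg]; simp)
  · intro f r _ _ f' r' _ _ h
    obtain ⟨h, rfl⟩ := Prod.mk.inj h
    refine Prod.ext (funext fun i => ?_) rfl
    have hi := congrFun h i
    rcases eq_or_ne i r with rfl | e
    · simpa using hi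
    · simpa [e] using hi
  · intro g r ⟨hg, hr⟩ hne
    have hlt : g (r + 1) < g r := by
      by_contra h
      exact hne (by rw [downWeight_eq_zero hg hr (not_lt.1 h)]; simp)
    have hf := update_pred_mem_diagrams hg hr hlt
    have hgr : g r - 1 + 1 = g r := by omega
    have e : Function.update (Function.update g r (g r - 1)) r
        (Function.update g r (g r - 1) r + 1) = g := by simp [hgr]
    refine ⟨(Function.update g r (g r - 1), r), ⟨hf, hr⟩, ?_, by rw [e]⟩
    dsimp only
    rw [upWeight_div_rowHookProd hα (mem_diagrams.1 hf).1 hr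
      (by rw [e]; exact (mem_diagrams.1 hg).1), ← contentSum_update _ _ hr, e]
    exact hne
  · intro f r ⟨hf, hr⟩ hne
    have hg : Antitone (Function.update f r (f r + 1)) := by
      by_contra hg
      exact hne (by rw [upWeight_eq_zero (mem_diagrams.1 hf).1 hr hg]; simp)
    rw [upWeight_div_rowHookProd hα (mem_diagrams.1 hf).1 hr hg, contentSum_update _ _ hr]

lemma sum_contentSum_div_rowHookProd (hα : 0 < α) (hm : m ≤ M) :
    ∑ f ∈ diagrams M m, contentSum α M f / rowHookProd α M f = 0 := by
  induction m with
  | zero =>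
    refine sum_eq_zero fun f hf => ?_
    have h0 : ∀ i ∈ range M, f i = 0 := sum_eq_zero_iff.1 (mem_diagrams.1 hf).2.1
    rw [contentSum, sum_eq_zero (fun i hi => by simp [h0 i hi]), zero_div]
  | succ m ih =>
    have h := sum_downWeight_eq_sum_upWeight hα M m
    have h1 : ∑ g ∈ diagrams M (m + 1), ∑ r ∈ range M,
        downWeight α M g r / rowHookProd α M g * contentSum α M g =
        α * (m + 1 : ℕ) * ∑ g ∈ diagrams M (m + 1), contentSum α M g / rowHookProd α M g := by
      rw [mul_sum]
      refine sum_congr rfl fun g hg => ?_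
      rw [← sum_downWeight hα hg, sum_mul]
      exact sum_congr rfl fun r _ => by ring
    have h2 : ∑ f ∈ diagrams M m, ∑ r ∈ range M,
        upWeight α M f r / rowHookProd α M f * (contentSum α M f + rowContent α f r) =
        ∑ f ∈ diagrams M m, contentSum α M f / rowHookProd α M f := by
      refine sum_congr rfl fun f hf => ?_
      calc _ = (∑ r ∈ range M, upWeight α M f r) * contentSum α M f / rowHookProd α M f +
            (∑ r ∈ range M, upWeight α M f r * rowContent α f r) / rowHookProd α M f := by
            rw [sum_mul, sum_div, sum_div, ← sum_add_distrib]
            exact sum_congr rfl fun r _ => by ring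
        _ = _ := by
            rw [sum_upWeight hα hm hf, sum_upWeight_mul_rowContent hα hm hf]; ring
    rw [h1, h2, ih (by omega)] at h
    exact (mul_eq_zero.1 h).resolve_left (by positivity)

end Growth

section Partition

variable {n : ℕ}

lemma filter_lt_range {a N : ℕ} (h : a ≤ N) : {i ∈ range N | i < a} = range a := by
  ext i; simp; omega

lemma lt_card_filter_iff {g : ℕ → ℕ} {N : ℕ} (hg : Antitone g) (hN : g N = 0) {i j : ℕ} :
    j < #{k ∈ range N | i < g k} ↔ i < g j := by
  constructor
  · intro h
    by_contra! hij
    have : {k ∈ range N | i < g k} ⊆ range j := fun k hk => by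
      rw [mem_filter] at hk
      by_contra hkj
      have := hg (show j ≤ k by simpa using hkj)
      omega
    have := card_le_card this
    rw [card_range] at this
    omega
  · intro h
    have : range (j + 1) ⊆ {k ∈ range N | i < g k} := fun k hk => by
      have h1 := hg (show k ≤ j by simpa [Nat.lt_succ_iff] using hk)
      refine mem_filter.2 ⟨mem_range.2 ?_, by omega⟩
      by_contra! hNk
      have := hg hNk
      omega
    have := card_le_card this
    rw [card_range] at this
    omega

lemma colLen_antitone (lam : n.Partition) : Antitone (colLen lam) := fun _ _ hij =>
  Multiset.card_le_card (Multiset.monotone_filter_right _ fun _ h => hij.trans_lt h)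

lemma parts_le (lam : n.Partition) {p : ℕ} (hp : p ∈ lam.parts) : p ≤ n := by
  have := Multiset.le_sum_of_mem hp
  rwa [lam.parts_sum] at this

lemma colLen_size (lam : n.Partition) : colLen lam n = 0 := by
  rw [colLen, Multiset.card_eq_zero, Multiset.filter_eq_nil]
  exact fun p hp => not_lt.2 (parts_le lam hp)

lemma sum_card_filter_lt (s : Multiset ℕ) (N : ℕ) (hs : ∀ p ∈ s, p ≤ N) :
    ∑ j ∈ range N, (s.filter (fun p => j < p)).card = s.sum := by
  induction s using Multiset.induction_on with
  | empty => simp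
  | cons a s ih =>
    rw [Multiset.sum_cons, ← ih fun p hp => hs p (Multiset.mem_cons_of_mem hp)]
    have h : ∑ j ∈ range N, (if j < a then 1 else 0) = a := by
      rw [← card_filter, filter_lt_range (hs a (Multiset.mem_cons_self a s)), card_range]
    conv_rhs => rw [← h]
    rw [← sum_add_distrib]
    refine sum_congr rfl fun j _ => ?_
    rw [← Multiset.countP_eq_card_filter, ← Multiset.countP_eq_card_filter,
      Multiset.countP_cons, add_comm]

lemma sum_colLen (lam : n.Partition) : ∑ j ∈ range n, colLen lam j = n :=
  (sum_card_filter_lt _ _ fun _ => parts_le lam).trans lam.parts_sum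

lemma colLen_le (lam : n.Partition) (j : ℕ) : colLen lam j ≤ n := by
  rcases lt_or_ge j n with h | h
  · exact (single_le_sum (fun _ _ => Nat.zero_le _) (mem_range.2 h)).trans (sum_colLen lam).le
  · have := colLen_antitone lam h
    rw [colLen_size] at this
    omega

lemma lt_rowLen_iff (lam : n.Partition) {i j : ℕ} : j < rowLen lam i ↔ i < colLen lam j :=
  lt_card_filter_iff (colLen_antitone lam) (colLen_size lam)

lemma rowLen_le (lam : n.Partition) (i : ℕ) : rowLen lam i ≤ n :=
  (card_filter_le _ _).trans (card_range n).le

lemma rowLen_antitone (lam : n.Partition) : Antitone (rowLen lam) := fun i j hij => by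
  by_contra! h
  have := (lt_rowLen_iff lam).1 h
  exact lt_irrefl _ ((lt_rowLen_iff lam).2 (hij.trans_lt this))

lemma sum_mul_colLen (lam : n.Partition) (w : ℕ → ℕ) :
    ∑ j ∈ range n, w j * colLen lam j = ∑ i ∈ range n, ∑ j ∈ range (rowLen lam i), w j := by
  calc ∑ j ∈ range n, w j * colLen lam j
      = ∑ j ∈ range n, ∑ i ∈ range n, if i < colLen lam j then w j else 0 := by
        refine sum_congr rfl fun j _ => ?_
        rw [← sum_filter, filter_lt_range (colLen_le lam j), sum_const, card_range, smul_eq_mul,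
          mul_comm]
    _ = _ := by
        rw [sum_comm]
        refine sum_congr rfl fun i _ => ?_
        simp only [← lt_rowLen_iff]
        rw [← sum_filter, filter_lt_range (rowLen_le lam i)]

lemma rowLen_mem_diagrams (lam : n.Partition) : rowLen lam ∈ diagrams n n := by
  refine mem_diagrams.2 ⟨rowLen_antitone lam, ?_, fun i hi => ?_⟩
  · have := sum_mul_colLen lam fun _ => 1
    simp only [one_mul, sum_colLen, sum_const, card_range, smul_eq_mul, mul_one] at this
    exact this.symm
  · exact ((lt_rowLen_iff lam).1 (Nat.pos_of_ne_zero hi)).trans_le (colLen_le lam 0)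

lemma rowLen_injective : Function.Injective (rowLen : n.Partition → ℕ → ℕ) := by
  intro lam mu h
  have hcol : colLen lam = colLen mu := by
    funext j
    refine eq_of_forall_lt_iff fun i => ?_
    rw [← lt_rowLen_iff, ← lt_rowLen_iff, h]
  have hcount : ∀ (nu : n.Partition) (p : ℕ),
      nu.parts.count (p + 1) + colLen nu (p + 1) = colLen nu p := fun nu p => by
    rw [colLen, colLen, Multiset.count, ← Multiset.countP_eq_card_filter,
      ← Multiset.countP_eq_card_filter]
    induction nu.parts using Multiset.induction_on with
    | empty => simp
    | cons a s ih =>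
      simp only [Multiset.countP_cons]
      rw [← ih]
      split_ifs <;> omega
  refine Nat.Partition.ext (Multiset.ext.2 fun p => ?_)
  cases p with
  | zero =>
    rw [Multiset.count_eq_zero_of_notMem fun h => (lam.parts_pos h).ne rfl,
      Multiset.count_eq_zero_of_notMem fun h => (mu.parts_pos h).ne rfl]
  | succ p =>
    have h1 := hcount lam p
    have h2 := hcount mu p
    rw [hcol] at h1
    omega

lemma exists_rowLen_eq {f : ℕ → ℕ} (hf : f ∈ diagrams n n) :
    ∃ lam : n.Partition, rowLen lam = f := by
  obtain ⟨hf, hn, hM⟩ := mem_diagrams.1 hf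
  have hfn : f n = 0 := by
    by_contra h
    exact lt_irrefl _ (hM n h)
  let lam := Nat.Partition.ofSums n ((range n).val.map f) hn
  refine ⟨lam, funext fun i => eq_of_forall_lt_iff fun j => ?_⟩
  rw [lt_rowLen_iff, ← lt_card_filter_iff hf hfn]
  have : colLen lam j = #{k ∈ range n | j < f k} := by
    change (Multiset.filter _ (Multiset.filter _ (Multiset.map f (range n).val))).card = _
    rw [Multiset.filter_filter, Multiset.filter_map, Multiset.card_map]
    rw [card_def, filter_val]
    congr 1
    refine Multiset.filter_congr fun k _ => ?_
    simp only [Function.comp_apply]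
    omega
  rw [this]

lemma sum_partition_eq_sum_diagrams (φ : (ℕ → ℕ) → ℝ) :
    ∑ lam : n.Partition, φ (rowLen lam) = ∑ f ∈ diagrams n n, φ f :=
  sum_nbij rowLen (fun lam _ => rowLen_mem_diagrams lam) rowLen_injective.injOn
    (fun _ hf => (exists_rowLen_eq hf).imp fun _ h => ⟨by simp, h⟩) fun _ _ => rfl

lemma prod_telescope {G : ℕ → ℝ} {c N : ℕ} (hc : c ≤ N) (hG : ∀ k, c ≤ k → G k ≠ 0) :
    G N * ∏ k ∈ range N, (if c ≤ k then G k / G (k + 1) else 1) = G c := by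
  induction N, hc using Nat.le_induction with
  | base => rw [prod_eq_one (fun k hk => if_neg (by simpa using hk)), mul_one]
  | succ N hN ih =>
    rw [prod_range_succ, if_pos hN, ← ih]
    have := hG (N + 1) (by omega)
    field_simp

lemma hookProd_sub (α d : ℝ) (a b : ℕ) :
    hookProd α d (a - b) =
      ∏ j ∈ range a, if b ≤ j then hook α (a - (j + 1) : ℕ) d else 1 := by
  rw [← prod_range_reflect, ← prod_filter, hookProd]
  refine prod_congr ?_ fun t ht => ?_
  · ext t; simp; omega
  · simp only [mem_filter, mem_range] at ht
    rw [show a - (a - 1 - t + 1) = t by omega]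

lemma cLow_mul_cUp {α : ℝ} (hα : 0 < α) (lam : n.Partition) :
    cLow α lam * cUp α lam = rowHookProd α n (rowLen lam) := by
  calc cLow α lam * cUp α lam = ∏ s ∈ cells lam, hook α (arm lam s) (leg lam s) :=
        prod_mul_distrib.symm
    _ = ∏ i ∈ range n, ∏ j ∈ range (rowLen lam i), hook α (arm lam (i, j)) (leg lam (i, j)) := by
        rw [cells, prod_filter, prod_product]
        refine prod_congr rfl fun i _ => ?_
        dsimp only
        rw [← prod_filter, filter_lt_range (rowLen_le lam i)]
    _ = _ := by
        rw [rowHookProd, ← prod_mul_distrib]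
        refine prod_congr rfl fun i _ => ?_
        have h0 := hookProd_sub α (n - i - 1) (rowLen lam i) 0
        simp only [Nat.sub_zero, Nat.zero_le, if_true] at h0
        have h1 : ∀ k ∈ range n, (if i < k then hookProd α (k - i - 1) (rowLen lam i - rowLen lam k)
              / hookProd α (k - i) (rowLen lam i - rowLen lam k) else 1) =
            ∏ j ∈ range (rowLen lam i), if colLen lam j ≤ k then
              hook α (rowLen lam i - (j + 1) : ℕ) (k - i - 1) /
                hook α (rowLen lam i - (j + 1) : ℕ) ((k + 1 : ℕ) - i - 1) else 1 := fun k _ => by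
          have hk : ∀ j, rowLen lam k ≤ j ↔ colLen lam j ≤ k := fun j => by
            rw [← not_lt, lt_rowLen_iff, not_lt]
          split_ifs with hik
          · rw [hookProd_sub, hookProd_sub, ← prod_div_distrib]
            refine prod_congr rfl fun j _ => ?_
            simp only [hk]
            split_ifs
            · push_cast
              congr 2
              ring
            · simp
          · refine (prod_eq_one fun j hj => if_neg ?_).symm
            have := (lt_rowLen_iff lam).1 (mem_range.1 hj)
            omega
        rw [prod_congr rfl h1, prod_comm, h0, ← prod_mul_distrib]
        refine prod_congr rfl fun j hj => ?_
        have hij := (lt_rowLen_iff lam).1 (mem_range.1 hj)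
        have := prod_telescope (G := fun k => hook α (rowLen lam i - (j + 1) : ℕ) (k - i - 1))
          (colLen_le lam j) fun k hk => by
            have : (i : ℝ) + 1 ≤ k := by exact_mod_cast hij.trans_le hk
            exact (hook_pos hα (Nat.cast_nonneg _) (by linarith)).ne'
        rw [this, arm, leg]
        dsimp only
        rw [Nat.cast_sub (show i + 1 ≤ colLen lam j from hij)]
        push_cast
        congr 1
        ring

lemma nStat_eq_contentSum (α : ℝ) (lam : n.Partition) :
    α * nStatConj lam - nStat lam = contentSum α n (rowLen lam) := by
  have h : ∀ a : ℕ, ((∑ j ∈ range a, j : ℕ) : ℝ) = a * (a - 1) / 2 := fun a => by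
    induction a with
    | zero => simp
    | succ a ih => rw [sum_range_succ, Nat.cast_add, ih]; push_cast; ring
  rw [nStatConj, sum_mul_colLen, nStat, contentSum, sum_sub_distrib, ← mul_sum]
  push_cast [← h]
  rfl

end Partition

/-- The mean of `W_α` under Jack measure is zero. -/
theorem jack_W_mean_zero (α : ℝ) (hα : 1 ≤ α) (n : ℕ) (hn : 2 ≤ n) :
    (∑ lam : n.Partition, jackP α lam * W α lam) = 0 := by
  have hα : 0 < α := by linarith
  have h : ∀ lam : n.Partition, jackP α lam * W α lam =
      α ^ n * n.factorial / Real.sqrt (α * n.choose 2) *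
        (contentSum α n (rowLen lam) / rowHookProd α n (rowLen lam)) := fun lam => by
    rw [jackP, W, cLow_mul_cUp hα, nStat_eq_contentSum]
    ring
  rw [sum_congr rfl fun lam _ => h lam, ← mul_sum,
    sum_partition_eq_sum_diagrams fun f => contentSum α n f / rowHookProd α n f,
    sum_contentSum_div_rowHookProd hα le_rfl, mul_zero]

end JackTest
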